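/- There exists an absolute constant C > 0 such that the following holds (Vaughan's identity in F_q[x]). Let F_q be a finite field, n a positive integer, and Ψ : F_q[x] → ℂ a function with |Ψ(f)| ≤ 1 for all f. If u and v are two integers in [1, n] with u + v ≤ n, then |Σ_{f ∈ M(n)} Λ(f) Ψ(f)| ≤ C ( n Σ_1 + n^{5/2} q^{n−(u+v)/2} Σ_2^{1/2} ), where Σ_1 = Σ_{g monic, deg g ≤ u+v} |Σ_{h monic, deg h = n − deg g} Ψ(gh)| and Σ_2 = max_{v ≤ i ≤ n−u} max_{g_1 monic, deg g_1 = n−i} Σ_{g_2 monic, deg g_2 = n−i} |Σ_{h monic, deg h = i} Ψ(h g_1) · conj(Ψ(h g_2))|. -/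

import Mathlib

open Polynomial Finset

noncomputable section
open scoped Classical

/-- The monic polynomial of degree `k` whose lower-order coefficients are given by the
vector `v ∈ F^k`; this identifies `F^k` with the monic polynomials of degree `k`. -/
def vecToPoly {F : Type} [Semiring F] {k : ℕ} (v : Fin k → F) : Polynomial F :=
  Polynomial.X ^ k + ∑ i : Fin k, Polynomial.C (v i) * Polynomial.X ^ (i : ℕ)

/-- The von Mangoldt function on `F_q[x]`: `Λ(f) = deg P` if `f = P^r` for a monic
irreducible `P` and `r ≥ 1`, and `Λ(f) = 0` otherwise. -/
def ffLambda {F : Type} [Field F] (f : Polynomial F) : ℕ :=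
  if h : ∃ P : Polynomial F, P.Monic ∧ Irreducible P ∧ ∃ r : ℕ, 1 ≤ r ∧ f = P ^ r then
    h.choose.natDegree
  else 0


section helpers
set_option linter.unusedSectionVars false
variable {F : Type} [Field F] [Fintype F]

/-- monic polynomials of degree `d` -/
def MM (F : Type) [Field F] [Fintype F] (d : ℕ) : Finset (Polynomial F) :=
  (Finset.univ : Finset (Fin d → F)).image vecToPoly

lemma vecToPoly_low_degree {d : ℕ} (w : Fin d → F) :
    (∑ i : Fin d, Polynomial.C (w i) * Polynomial.X ^ (i : ℕ)).degree < (d : WithBot ℕ) := by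
  have := Polynomial.degree_sum_fin_lt w
  simpa using this

lemma vecToPoly_monic {d : ℕ} (w : Fin d → F) : (vecToPoly w).Monic :=
  Polynomial.monic_X_pow_add (vecToPoly_low_degree w)

lemma vecToPoly_natDegree {d : ℕ} (w : Fin d → F) : (vecToPoly w).natDegree = d := by
  unfold vecToPoly
  rw [Polynomial.natDegree_add_eq_left_of_degree_lt]
  · simp
  · simpa using vecToPoly_low_degree w

lemma vecToPoly_coeff {d : ℕ} (w : Fin d → F) (i : Fin d) : (vecToPoly w).coeff i = w i := by
  unfold vecToPoly
  rw [Polynomial.coeff_add, Polynomial.coeff_X_pow, if_neg (by have := i.2; omega), zero_add,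
    Polynomial.finsetSum_coeff, Finset.sum_eq_single i]
  · simp
  · intro j _ hj
    rw [Polynomial.coeff_C_mul, Polynomial.coeff_X_pow, if_neg, mul_zero]
    intro h
    exact hj (Fin.ext h.symm)
  · simp

lemma vecToPoly_inj {d : ℕ} : Function.Injective (vecToPoly : (Fin d → F) → Polynomial F) := by
  intro a b h
  funext i
  rw [← vecToPoly_coeff a i, h, vecToPoly_coeff]

lemma mem_MM {d : ℕ} {f : Polynomial F} : f ∈ MM F d ↔ f.Monic ∧ f.natDegree = d := by
  unfold MM
  simp only [Finset.mem_image, Finset.mem_univ, true_and]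
  constructor
  · rintro ⟨w, rfl⟩
    exact ⟨vecToPoly_monic w, vecToPoly_natDegree w⟩
  · rintro ⟨hm, rfl⟩
    refine ⟨fun i => f.coeff i, ?_⟩
    conv_rhs => rw [hm.as_sum]
    unfold vecToPoly
    rw [Finset.sum_range]

lemma card_MM (d : ℕ) : (MM F d).card = Fintype.card F ^ d := by
  unfold MM
  rw [Finset.card_image_of_injective _ vecToPoly_inj]
  simp

lemma sum_MM {R : Type*} [AddCommMonoid R] (d : ℕ) (φ : Polynomial F → R) :
    ∑ w : Fin d → F, φ (vecToPoly w) = ∑ f ∈ MM F d, φ f := by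
  unfold MM
  rw [Finset.sum_image (fun a _ b _ h => vecToPoly_inj h)]

/-- monic divisors -/
def DD (f : Polynomial F) : Finset (Polynomial F) :=
  ((Finset.range (f.natDegree + 1)).biUnion (MM F)).filter (· ∣ f)

lemma mem_DD {f b : Polynomial F} (hf : f.Monic) : b ∈ DD f ↔ b.Monic ∧ b ∣ f := by
  unfold DD
  simp only [Finset.mem_filter, Finset.mem_biUnion, Finset.mem_range, mem_MM]
  constructor
  · rintro ⟨⟨i, _, h, _⟩, h2⟩
    exact ⟨h, h2⟩
  · rintro ⟨h, h2⟩
    exact ⟨⟨_, Nat.lt_succ_of_le (Polynomial.natDegree_le_of_dvd h2 hf.ne_zero), h, rfl⟩, h2⟩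

lemma mem_DD' {f b : Polynomial F} (hf : f.Monic) :
    b ∈ DD f ↔ b.Monic ∧ ∃ c, c.Monic ∧ f = b * c := by
  rw [mem_DD hf]
  constructor
  · rintro ⟨h, c, rfl⟩
    exact ⟨h, c, h.of_mul_monic_left hf, rfl⟩
  · rintro ⟨h, c, _, rfl⟩
    exact ⟨h, dvd_mul_right _ _⟩

lemma mul_div_left' {b c : Polynomial F} (hb : b.Monic) : b * c / b = c :=
  mul_div_cancel_left₀ c hb.ne_zero

lemma mul_div_right' {b c : Polynomial F} (hc : c.Monic) : b * c / c = b :=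
  mul_div_cancel_right₀ b hc.ne_zero

/-- sum over products -/
lemma sum_DD_prod {R : Type*} [AddCommMonoid R] (n : ℕ)
    (Φ : Polynomial F → Polynomial F → R) :
    ∑ f ∈ MM F n, ∑ b ∈ DD f, Φ b (f / b) =
      ∑ i ∈ Finset.range (n + 1), ∑ b ∈ MM F i, ∑ g ∈ MM F (n - i), Φ b g := by
  have hR : ∀ i, ∑ b ∈ MM F i, ∑ g ∈ MM F (n - i), Φ b g =
      ∑ p ∈ (MM F i) ×ˢ (MM F (n - i)), Φ p.1 p.2 := fun i => by
    rw [Finset.sum_product]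
  simp only [hR]
  rw [Finset.sum_sigma', Finset.sum_sigma']
  refine Finset.sum_bij' (fun x _ => ⟨x.2.natDegree, (x.2, x.1 / x.2)⟩)
    (fun y _ => ⟨y.2.1 * y.2.2, y.2.1⟩) ?_ ?_ ?_ ?_ ?_
  · rintro ⟨f, b⟩ h
    simp only [Finset.mem_sigma, mem_MM] at h
    obtain ⟨⟨hf, hn⟩, h2⟩ := h
    rw [mem_DD' hf] at h2
    obtain ⟨hb, c, hc, rfl⟩ := h2
    rw [hb.natDegree_mul hc] at hn
    simp only [Finset.mem_sigma, Finset.mem_range, Finset.mem_product, mem_MM, mul_div_left' hb]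
    exact ⟨by omega, ⟨hb, trivial⟩, hc, by omega⟩
  · rintro ⟨i, b, c⟩ h
    simp only [Finset.mem_sigma, Finset.mem_range, Finset.mem_product, mem_MM] at h ⊢
    obtain ⟨hi, ⟨hb, rfl⟩, hc, hd⟩ := h
    rw [mem_DD (hb.mul hc), hb.natDegree_mul hc]
    exact ⟨⟨hb.mul hc, by omega⟩, hb, dvd_mul_right _ _⟩
  · rintro ⟨f, b⟩ h
    simp only [Finset.mem_sigma, mem_MM] at h
    obtain ⟨⟨hf, hn⟩, h2⟩ := h
    rw [mem_DD' hf] at h2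
    obtain ⟨hb, c, hc, rfl⟩ := h2
    simp only [mul_div_left' hb]
  · rintro ⟨i, b, c⟩ h
    simp only [Finset.mem_sigma, Finset.mem_range, Finset.mem_product, mem_MM] at h ⊢
    obtain ⟨hi, ⟨hb, rfl⟩, hc, hd⟩ := h
    simp only [mul_div_left' hb]
  · rintro ⟨f, b⟩ h
    rfl

lemma sum_DD_comm {R : Type*} [AddCommMonoid R] {f : Polynomial F} (hf : f.Monic)
    (Φ : Polynomial F → Polynomial F → R) :
    ∑ b ∈ DD f, ∑ c ∈ DD (f / b), Φ b c = ∑ c ∈ DD f, ∑ b ∈ DD (f / c), Φ b c := by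
  have key : ∀ b c : Polynomial F, b ∈ DD f ∧ c ∈ DD (f / b) ↔ b.Monic ∧ c.Monic ∧ b * c ∣ f := by
    intro b c
    constructor
    · rintro ⟨hb, hc⟩
      rw [mem_DD' hf] at hb
      obtain ⟨hb, d, hd, rfl⟩ := hb
      rw [mul_div_left' hb, mem_DD hd] at hc
      exact ⟨hb, hc.1, mul_dvd_mul_left _ hc.2⟩
    · rintro ⟨hb, hc, d, rfl⟩
      have hd : d.Monic := (hb.mul hc).of_mul_monic_left hf
      rw [mem_DD hf, mul_assoc, mul_div_left' hb, mem_DD (hc.mul hd)]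
      exact ⟨⟨hb, dvd_mul_right _ _⟩, hc, dvd_mul_right _ _⟩
  refine Finset.sum_comm' fun b c => ?_
  rw [key, and_comm (a := b ∈ _), key, mul_comm c b]
  tauto

lemma sum_DD_assoc {R : Type*} [AddCommMonoid R] {f : Polynomial F} (hf : f.Monic)
    (Φ : Polynomial F → Polynomial F → R) :
    ∑ b ∈ DD f, ∑ c ∈ DD (f / b), Φ b c = ∑ e ∈ DD f, ∑ b ∈ DD e, Φ b (e / b) := by
  rw [Finset.sum_sigma', Finset.sum_sigma']
  refine Finset.sum_bij' (fun x _ => ⟨x.1 * x.2, x.1⟩) (fun y _ => ⟨y.2, y.1 / y.2⟩) ?_ ?_ ?_ ?_ ?_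
  · rintro ⟨b, c⟩ h
    simp only [Finset.mem_sigma] at h ⊢
    obtain ⟨hb, hc⟩ := h
    rw [mem_DD' hf] at hb
    obtain ⟨hb, d, hd, rfl⟩ := hb
    rw [mul_div_left' hb, mem_DD hd] at hc
    rw [mem_DD hf, mem_DD (hb.mul hc.1)]
    exact ⟨⟨hb.mul hc.1, mul_dvd_mul_left _ hc.2⟩, hb, dvd_mul_right _ _⟩
  · rintro ⟨e, b⟩ h
    simp only [Finset.mem_sigma] at h ⊢
    obtain ⟨he, hb⟩ := h
    rw [mem_DD' hf] at he
    obtain ⟨he, d, hd, rfl⟩ := he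
    rw [mem_DD' he] at hb
    obtain ⟨hb, c, hc, rfl⟩ := hb
    rw [mem_DD hf, mul_div_left' hb, mul_assoc, mul_div_left' hb, mem_DD (hc.mul hd)]
    exact ⟨⟨hb, dvd_mul_right _ _⟩, hc, dvd_mul_right _ _⟩
  · rintro ⟨b, c⟩ h
    simp only [Finset.mem_sigma] at h
    obtain ⟨hb, hc⟩ := h
    rw [mem_DD hf] at hb
    simp only [mul_div_left' hb.1]
  · rintro ⟨e, b⟩ h
    simp only [Finset.mem_sigma] at h
    obtain ⟨he, hb⟩ := h
    rw [mem_DD hf] at he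
    rw [mem_DD' he.1] at hb
    obtain ⟨hb, c, hc, rfl⟩ := hb
    simp only [mul_div_left' hb]
  · rintro ⟨b, c⟩ h
    simp only [Finset.mem_sigma] at h
    obtain ⟨hb, hc⟩ := h
    rw [mem_DD hf] at hb
    simp only [mul_div_left' hb.1]

lemma sum_DD_flip {R : Type*} [AddCommMonoid R] {f : Polynomial F} (hf : f.Monic)
    (φ : Polynomial F → R) : ∑ b ∈ DD f, φ (f / b) = ∑ b ∈ DD f, φ b := by
  refine Finset.sum_bij' (fun b _ => f / b) (fun b _ => f / b) ?_ ?_ ?_ ?_ ?_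
  iterate 2
    · intro b hb
      rw [mem_DD' hf] at hb
      obtain ⟨hb, c, hc, rfl⟩ := hb
      rw [mem_DD hf, mul_div_left' hb]
      exact ⟨hc, dvd_mul_left _ _⟩
  iterate 2
    · intro b hb
      rw [mem_DD' hf] at hb
      obtain ⟨hb, c, hc, rfl⟩ := hb
      simp only [mul_div_left' hb, mul_div_right' hc]
  · intro b hb
    rfl

lemma ffLambda_pow {P : Polynomial F} (hm : P.Monic) (hi : Irreducible P) {r : ℕ} (hr : 1 ≤ r) :
    ffLambda (P ^ r) = P.natDegree := by
  have h : ∃ Q : Polynomial F, Q.Monic ∧ Irreducible Q ∧ ∃ s : ℕ, 1 ≤ s ∧ P ^ r = Q ^ s :=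
    ⟨P, hm, hi, r, hr, rfl⟩
  unfold ffLambda
  rw [dif_pos h]
  obtain ⟨h1, h2, s, hs, h3⟩ := h.choose_spec
  have : P ∣ h.choose := hi.prime.dvd_of_dvd_pow (h3 ▸ dvd_pow_self P (by omega))
  exact (congrArg Polynomial.natDegree
    (Polynomial.eq_of_monic_of_associated hm h1 (hi.associated_of_dvd h2 this))).symm

lemma ffLambda_ne {f : Polynomial F} (h : ffLambda f ≠ 0) :
    ∃ P : Polynomial F, P.Monic ∧ Irreducible P ∧ ∃ r : ℕ, 1 ≤ r ∧ f = P ^ r := by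
  by_contra h'
  exact h (by unfold ffLambda; rw [dif_neg h'])

lemma sum_ffLambda_step {P g : Polynomial F} (hP : P.Monic) (hi : Irreducible P) (hg : g.Monic) :
    ∑ c ∈ DD (P * g), ffLambda c = P.natDegree + ∑ c ∈ DD g, ffLambda c := by
  obtain ⟨k, a, ha, hga⟩ := WfDvdMonoid.max_power_factor hg.ne_zero hi
  have hnot : P ^ (k + 1) ∉ DD g := by
    rw [mem_DD hg, hga, pow_succ]
    rintro ⟨_, h⟩
    exact ha ((mul_dvd_mul_iff_left (pow_ne_zero k hP.ne_zero)).1 h)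
  rw [← ffLambda_pow hP hi (r := k + 1) (by omega), ← Finset.sum_insert hnot]
  symm
  refine Finset.sum_subset ?_ ?_
  · intro c hc
    rw [mem_DD (hP.mul hg)]
    rw [Finset.mem_insert, mem_DD hg] at hc
    rcases hc with rfl | ⟨h1, h2⟩
    · refine ⟨hP.pow _, ?_⟩
      rw [hga, pow_succ', ← mul_assoc]
      exact dvd_mul_right _ _
    · exact ⟨h1, h2.mul_left _⟩
  · intro c hc hc'
    by_contra hne
    apply hc'
    obtain ⟨Q, hQ, hQi, r, hr, rfl⟩ := ffLambda_ne hne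
    rw [mem_DD (hP.mul hg)] at hc
    rw [Finset.mem_insert, mem_DD hg]
    by_cases hQP : Q ∣ P
    · have : Q = P := Polynomial.eq_of_monic_of_associated hQ hP (hQi.associated_of_dvd hi hQP)
      subst this
      have hle : r ≤ k + 1 := by
        by_contra hlt
        have h2 : Q ^ (k + 2) ∣ Q * g := (pow_dvd_pow Q (by omega)).trans hc.2
        rw [hga, ← mul_assoc, ← pow_succ', show k + 2 = (k + 1) + 1 from rfl, pow_succ Q (k + 1)] at h2
        exact ha ((mul_dvd_mul_iff_left (pow_ne_zero _ hP.ne_zero)).1 h2)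
      rcases Nat.lt_or_ge k r with h | h
      · left
        rw [show r = k + 1 by omega]
      · right
        refine ⟨hQ.pow _, ?_⟩
        rw [hga]
        exact (pow_dvd_pow Q h).mul_right _
    · right
      exact ⟨hQ.pow _, hQi.prime.pow_dvd_of_dvd_mul_left r hQP hc.2⟩

lemma exists_factor {f : Polynomial F} (hf : f.Monic) (h1 : f ≠ 1) :
    ∃ P g : Polynomial F, P.Monic ∧ Irreducible P ∧ g.Monic ∧ f = P * g := by
  have hu : ¬ IsUnit f := fun h => h1 (hf.isUnit_iff.1 h)
  obtain ⟨P, hP, hi, g, rfl⟩ := Polynomial.exists_monic_irreducible_factor f hu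
  exact ⟨P, g, hP, hi, hP.of_mul_monic_left hf, rfl⟩

lemma DD_one : DD (1 : Polynomial F) = {1} := by
  ext b
  rw [mem_DD Polynomial.monic_one, Finset.mem_singleton]
  constructor
  · rintro ⟨h, h2⟩
    exact h.isUnit_iff.1 (isUnit_of_dvd_one h2)
  · rintro rfl
    exact ⟨Polynomial.monic_one, dvd_rfl⟩

lemma ffLambda_one : ffLambda (1 : Polynomial F) = 0 := by
  by_contra h
  obtain ⟨P, hP, hi, r, hr, h⟩ := ffLambda_ne h
  exact hi.not_isUnit (isUnit_of_dvd_one (h ▸ dvd_pow_self P (by omega)))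

lemma sum_ffLambda (d : ℕ) : ∀ f : Polynomial F, f.Monic → f.natDegree = d →
    ∑ c ∈ DD f, ffLambda c = f.natDegree := by
  induction d using Nat.strong_induction_on with
  | _ d ih =>
    intro f hf hd
    by_cases h1 : f = 1
    · subst h1
      rw [DD_one, Finset.sum_singleton, ffLambda_one, Polynomial.natDegree_one]
    · obtain ⟨P, g, hP, hi, hg, rfl⟩ := exists_factor hf h1
      have hpos := hi.natDegree_pos
      rw [hP.natDegree_mul hg] at hd ⊢
      rw [sum_ffLambda_step hP hi hg, ih g.natDegree (by omega) g hg rfl]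

/-- Moebius function -/
def mob (f : Polynomial F) : ℂ :=
  if Squarefree f then (-1) ^ (Multiset.card (UniqueFactorizationMonoid.normalizedFactors f)) else 0

lemma mob_norm (f : Polynomial F) : ‖mob f‖ ≤ 1 := by
  unfold mob
  split_ifs <;> simp

lemma mob_mul {P b : Polynomial F} (hi : Irreducible P) (hb : b ≠ 0) (h : ¬ P ∣ b) :
    mob (P * b) = - mob b := by
  have hs : Squarefree (P * b) ↔ Squarefree b := by
    rw [squarefree_mul_iff]
    exact ⟨fun h => h.2.2, fun h2 => ⟨hi.isRelPrime_iff_not_dvd.2 h, hi.squarefree, h2⟩⟩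
  unfold mob
  rw [UniqueFactorizationMonoid.normalizedFactors_mul hi.ne_zero hb,
    UniqueFactorizationMonoid.normalizedFactors_irreducible hi]
  simp only [hs]
  split_ifs
  · simp [pow_add]
  · simp

lemma sum_mob {f : Polynomial F} (hf : f.Monic) (h1 : f ≠ 1) : ∑ b ∈ DD f, mob b = 0 := by
  obtain ⟨P, g, hP, hi, hg, rfl⟩ := exists_factor hf h1
  have hfil : ∑ b ∈ DD (P * g), mob b = ∑ b ∈ (DD (P * g)).filter (fun b => Squarefree b), mob b := by
    rw [Finset.sum_filter]
    refine Finset.sum_congr rfl fun b _ => ?_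
    split_ifs with h
    · rfl
    · unfold mob
      rw [if_neg h]
  have hnot : ∀ c : Polynomial F, Squarefree (P * c) → ¬ P ∣ c := by
    rintro c hs ⟨d, rfl⟩
    exact hi.not_isUnit (hs P ⟨d, by ring⟩)
  rw [hfil]
  refine Finset.sum_involution (fun b _ => if P ∣ b then b / P else P * b) ?_ ?_ ?_ ?_
  · intro b hb
    rw [Finset.mem_filter, mem_DD hf] at hb
    obtain ⟨⟨hbm, hbd⟩, hs⟩ := hb
    split_ifs with h
    · obtain ⟨c, rfl⟩ := h
      rw [mul_div_left' hP, mob_mul hi (hP.of_mul_monic_left hbm).ne_zero (hnot c hs)]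
      ring
    · rw [mob_mul hi hbm.ne_zero h]
      ring
  · intro b hb _
    rw [Finset.mem_filter, mem_DD hf] at hb
    obtain ⟨⟨hbm, hbd⟩, hs⟩ := hb
    split_ifs with h
    · obtain ⟨c, rfl⟩ := h
      rw [mul_div_left' hP]
      intro h
      exact hnot c hs (h ▸ dvd_mul_right _ _)
    · intro h'
      exact h (h' ▸ dvd_mul_right _ _)
  · intro b hb
    rw [Finset.mem_filter, mem_DD hf] at hb
    obtain ⟨⟨hbm, hbd⟩, hs⟩ := hb
    rw [Finset.mem_filter, mem_DD hf]
    split_ifs with h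
    · obtain ⟨c, rfl⟩ := h
      rw [mul_div_left' hP]
      exact ⟨⟨hP.of_mul_monic_left hbm, (dvd_mul_left _ _).trans hbd⟩,
        hs.squarefree_of_dvd (dvd_mul_left _ _)⟩
    · have hr : IsRelPrime P b := hi.isRelPrime_iff_not_dvd.2 h
      refine ⟨⟨hP.mul hbm, hr.mul_dvd (dvd_mul_right _ _) hbd⟩, ?_⟩
      rw [squarefree_mul_iff]
      exact ⟨hr, hi.squarefree, hs⟩
  · intro b hb
    rw [Finset.mem_filter, mem_DD hf] at hb
    obtain ⟨⟨hbm, hbd⟩, hs⟩ := hb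
    by_cases h : P ∣ b
    · obtain ⟨c, rfl⟩ := h
      rw [if_pos (dvd_mul_right _ _), mul_div_left' hP, if_neg (hnot c hs)]
    · rw [if_neg h, if_pos (dvd_mul_right _ _), mul_div_left' hP]

lemma sum_mob_one : ∑ b ∈ DD (1 : Polynomial F), mob b = 1 := by
  rw [DD_one, Finset.sum_singleton]
  unfold mob
  rw [if_pos squarefree_one]
  simp

/-- truncated sums of the von Mangoldt function -/
def BB (u : ℕ) (g : Polynomial F) : ℂ :=
  ∑ c ∈ DD g, if u < c.natDegree then (ffLambda c : ℂ) else 0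

def AA (u : ℕ) (g : Polynomial F) : ℂ :=
  ∑ c ∈ DD g, if c.natDegree ≤ u then (ffLambda c : ℂ) else 0

lemma AA_add_BB (u : ℕ) {g : Polynomial F} (hg : g.Monic) :
    AA u g + BB u g = (g.natDegree : ℂ) := by
  unfold AA BB
  rw [← sum_ffLambda _ g hg rfl, ← Finset.sum_add_distrib]
  push_cast
  refine Finset.sum_congr rfl fun c _ => ?_
  by_cases h : c.natDegree ≤ u
  · rw [if_pos h, if_neg (by omega), add_zero]
  · rw [if_neg h, if_pos (by omega), zero_add]

lemma BB_norm (u : ℕ) {g : Polynomial F} (hg : g.Monic) : ‖BB u g‖ ≤ g.natDegree := by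
  unfold BB
  rw [← sum_ffLambda _ g hg rfl]
  push_cast
  refine (norm_sum_le _ _).trans (Finset.sum_le_sum fun c _ => ?_)
  split_ifs <;> simp

lemma BB_eq_zero {u : ℕ} {g : Polynomial F} (hg : g.Monic) (h : g.natDegree ≤ u) :
    BB u g = 0 := by
  unfold BB
  refine Finset.sum_eq_zero fun c hc => ?_
  rw [mem_DD hg] at hc
  have := Polynomial.natDegree_le_of_dvd hc.2 hg.ne_zero
  rw [if_neg (by omega)]

lemma ffLambda_eq_sum {u : ℕ} {f : Polynomial F} (hf : f.Monic) (hu : u < f.natDegree) :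
    (ffLambda f : ℂ) = ∑ b ∈ DD f, mob b * BB u (f / b) := by
  unfold BB
  simp only [Finset.mul_sum]
  rw [sum_DD_comm hf (fun b c => mob b * if u < c.natDegree then (ffLambda c : ℂ) else 0)]
  simp only [← Finset.sum_mul]
  rw [Finset.sum_eq_single f]
  · rw [EuclideanDomain.div_self hf.ne_zero, sum_mob_one, if_pos hu, one_mul]
  · intro c hc hne
    rw [mem_DD' hf] at hc
    obtain ⟨hc, d, hd, rfl⟩ := hc
    rw [mul_div_left' hc, sum_mob hd, zero_mul]
    rintro rfl
    exact hne (by simp)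
  · intro h
    exact absurd ((mem_DD hf).2 ⟨hf, dvd_rfl⟩) h

/-- coefficient of the second type I sum -/
def WW (u v : ℕ) (e : Polynomial F) : ℂ :=
  ∑ b ∈ DD e, if b.natDegree ≤ v then
    mob b * (if (e / b).natDegree ≤ u then (ffLambda (e / b) : ℂ) else 0) else 0

lemma WW_norm (u v : ℕ) {e : Polynomial F} (he : e.Monic) : ‖WW u v e‖ ≤ e.natDegree := by
  unfold WW
  rw [← sum_ffLambda _ e he rfl, ← sum_DD_flip he ffLambda]
  push_cast
  refine (norm_sum_le _ _).trans (Finset.sum_le_sum fun b _ => ?_)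
  have hm := mob_norm b
  split_ifs
  · rw [norm_mul, Complex.norm_natCast]
    exact mul_le_of_le_one_left (Nat.cast_nonneg _) hm
  · simp
  · simp

lemma WW_eq_zero {u v : ℕ} {e : Polynomial F} (he : e.Monic) (h : u + v < e.natDegree) :
    WW u v e = 0 := by
  unfold WW
  refine Finset.sum_eq_zero fun b hb => ?_
  rw [mem_DD' he] at hb
  obtain ⟨hb, c, hc, rfl⟩ := hb
  rw [mul_div_left' hb]
  rw [hb.natDegree_mul hc] at h
  split_ifs
  · omega
  · simp
  · rfl

lemma sum_AA (u v : ℕ) {f : Polynomial F} (hf : f.Monic) :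
    ∑ b ∈ DD f, (if b.natDegree ≤ v then mob b * AA u (f / b) else 0) = ∑ e ∈ DD f, WW u v e := by
  unfold WW
  rw [← sum_DD_assoc hf (fun b c => if b.natDegree ≤ v then
    mob b * (if c.natDegree ≤ u then (ffLambda c : ℂ) else 0) else 0)]
  refine Finset.sum_congr rfl fun b _ => ?_
  unfold AA
  split_ifs
  · rw [Finset.mul_sum]
  · simp

lemma vaughan_point {u v : ℕ} {f : Polynomial F} (hf : f.Monic) (hu : u < f.natDegree) (Ψ : Polynomial F → ℂ) :
    (ffLambda f : ℂ) * Ψ f =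
      (∑ b ∈ DD f, (if b.natDegree ≤ v then mob b * ((f / b).natDegree : ℂ) else 0) * Ψ (b * (f / b)))
      - (∑ e ∈ DD f, WW u v e * Ψ (e * (f / e)))
      + ∑ b ∈ DD f, (if v < b.natDegree then mob b * BB u (f / b) else 0) * Ψ (b * (f / b)) := by
  have hΨ : ∀ b ∈ DD f, Ψ (b * (f / b)) = Ψ f := by
    intro b hb
    rw [mem_DD' hf] at hb
    obtain ⟨hb, c, hc, rfl⟩ := hb
    rw [mul_div_left' hb]
  have e1 : ∀ φ : Polynomial F → ℂ, ∑ b ∈ DD f, φ b * Ψ (b * (f / b)) = (∑ b ∈ DD f, φ b) * Ψ f := by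
    intro φ
    rw [Finset.sum_mul]
    exact Finset.sum_congr rfl fun b hb => by rw [hΨ b hb]
  rw [e1, e1, e1, ← sub_mul, ← add_mul, ← sum_AA u v hf, ffLambda_eq_sum hf hu,
    ← Finset.sum_sub_distrib, ← Finset.sum_add_distrib]
  congr 1
  refine Finset.sum_congr rfl fun b hb => ?_
  rw [mem_DD' hf] at hb
  obtain ⟨hb, c, hc, rfl⟩ := hb
  rw [mul_div_left' hb, ← AA_add_BB u hc]
  by_cases h : b.natDegree ≤ v
  · rw [if_pos h, if_pos h, if_neg (by omega)]
    ring
  · rw [if_neg h, if_neg h, if_pos (by omega)]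
    ring

lemma cs_bound {α β : Type*} (H : Finset α) (G : Finset β) (m : α → ℂ) (a : β → ℂ)
    (K : α → β → ℂ) (N S : ℝ) (hN : 0 ≤ N) (hm : ∀ h ∈ H, ‖m h‖ ≤ 1) (ha : ∀ g ∈ G, ‖a g‖ ≤ N)
    (hS : ∀ g₁ ∈ G, ∑ g₂ ∈ G, ‖∑ h ∈ H, K h g₁ * (starRingEnd ℂ) (K h g₂)‖ ≤ S) :
    ‖∑ h ∈ H, ∑ g ∈ G, m h * a g * K h g‖ ^ 2 ≤ N ^ 2 * (H.card * G.card) * S := by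
  have h1 : ‖∑ h ∈ H, ∑ g ∈ G, m h * a g * K h g‖ ≤ ∑ h ∈ H, ‖∑ g ∈ G, a g * K h g‖ := by
    refine (norm_sum_le _ _).trans (Finset.sum_le_sum fun h hh => ?_)
    simp only [mul_assoc]
    rw [← Finset.mul_sum, norm_mul]
    exact mul_le_of_le_one_left (norm_nonneg _) (hm h hh)
  have h2 : ∑ h ∈ H, ‖∑ g ∈ G, a g * K h g‖ ^ 2 ≤ N ^ 2 * G.card * S := by
    have e : ((∑ h ∈ H, ‖∑ g ∈ G, a g * K h g‖ ^ 2 : ℝ) : ℂ) =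
        ∑ g₁ ∈ G, ∑ g₂ ∈ G, a g₁ * (starRingEnd ℂ) (a g₂) *
          ∑ h ∈ H, K h g₁ * (starRingEnd ℂ) (K h g₂) := by
      push_cast
      have : ∀ h ∈ H, ((‖∑ g ∈ G, a g * K h g‖ : ℂ)) ^ 2 = ∑ g₁ ∈ G, ∑ g₂ ∈ G,
          a g₁ * (starRingEnd ℂ) (a g₂) * (K h g₁ * (starRingEnd ℂ) (K h g₂)) := by
        intro h _
        rw [← Complex.mul_conj', map_sum, Finset.sum_mul_sum]
        refine Finset.sum_congr rfl fun g₁ _ => Finset.sum_congr rfl fun g₂ _ => ?_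
        rw [map_mul]
        ring
      rw [Finset.sum_congr rfl this, Finset.sum_comm]
      refine Finset.sum_congr rfl fun g₁ _ => ?_
      rw [Finset.sum_comm]
      refine Finset.sum_congr rfl fun g₂ _ => ?_
      rw [Finset.mul_sum]
    have e2 : ∑ h ∈ H, ‖∑ g ∈ G, a g * K h g‖ ^ 2 =
        ‖((∑ h ∈ H, ‖∑ g ∈ G, a g * K h g‖ ^ 2 : ℝ) : ℂ)‖ := by
      rw [Complex.norm_real, Real.norm_of_nonneg]
      exact Finset.sum_nonneg fun _ _ => by positivity
    rw [e2, e]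
    calc _ ≤ ∑ g₁ ∈ G, ∑ g₂ ∈ G, N ^ 2 * ‖∑ h ∈ H, K h g₁ * (starRingEnd ℂ) (K h g₂)‖ := by
          refine (norm_sum_le _ _).trans (Finset.sum_le_sum fun g₁ h₁ => ?_)
          refine (norm_sum_le _ _).trans (Finset.sum_le_sum fun g₂ h₂ => ?_)
          rw [norm_mul, norm_mul, RCLike.norm_conj, sq]
          have := ha g₁ h₁
          have := ha g₂ h₂
          gcongr
      _ ≤ ∑ g₁ ∈ G, N ^ 2 * S := by
          refine Finset.sum_le_sum fun g₁ h₁ => ?_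
          rw [← Finset.mul_sum]
          have := hS g₁ h₁
          gcongr
      _ = N ^ 2 * G.card * S := by
          rw [Finset.sum_const, nsmul_eq_mul]
          ring
  calc _ ≤ (∑ h ∈ H, ‖∑ g ∈ G, a g * K h g‖) ^ 2 := by gcongr
    _ ≤ H.card * ∑ h ∈ H, ‖∑ g ∈ G, a g * K h g‖ ^ 2 := sq_sum_le_card_mul_sum_sq
    _ ≤ H.card * (N ^ 2 * G.card * S) := by gcongr
    _ = _ := by ring

lemma typeI_bound {n m : ℕ} (hmn : m ≤ n) (w : Polynomial F → Polynomial F → ℂ)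
    (Ψ : Polynomial F → ℂ) (w' : Polynomial F → ℂ)
    (hw : ∀ i ≤ n, ∀ b ∈ MM F i, ∀ g ∈ MM F (n - i), w b g = w' b)
    (hw1 : ∀ i ≤ n, ∀ b ∈ MM F i, ‖w' b‖ ≤ n)
    (hw0 : ∀ i ≤ n, m < i → ∀ b ∈ MM F i, w' b = 0) :
    ‖∑ f ∈ MM F n, ∑ b ∈ DD f, w b (f / b) * Ψ (b * (f / b))‖ ≤
      n * ∑ d ∈ Finset.range (m + 1), ∑ g ∈ MM F d, ‖∑ h ∈ MM F (n - d), Ψ (g * h)‖ := by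
  rw [sum_DD_prod n (fun b g => w b g * Ψ (b * g))]
  have e : ∀ i ∈ Finset.range (n + 1), ∑ b ∈ MM F i, ∑ g ∈ MM F (n - i), w b g * Ψ (b * g) =
      ∑ b ∈ MM F i, w' b * ∑ g ∈ MM F (n - i), Ψ (b * g) := by
    intro i hi
    rw [Finset.mem_range] at hi
    refine Finset.sum_congr rfl fun b hb => ?_
    rw [Finset.mul_sum]
    exact Finset.sum_congr rfl fun g hg => by rw [hw i (by omega) b hb g hg]
  rw [Finset.sum_congr rfl e, ← Finset.sum_subset (s₁ := Finset.range (m + 1))]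
  · rw [Finset.mul_sum]
    refine (norm_sum_le _ _).trans (Finset.sum_le_sum fun i hi => ?_)
    rw [Finset.mem_range] at hi
    rw [Finset.mul_sum]
    refine (norm_sum_le _ _).trans (Finset.sum_le_sum fun b hb => ?_)
    rw [norm_mul]
    have := hw1 i (by omega) b hb
    gcongr
  · intro i
    simp only [Finset.mem_range]
    omega
  · intro i hi hi'
    rw [Finset.mem_range] at hi hi'
    refine Finset.sum_eq_zero fun b hb => ?_
    rw [hw0 i (by omega) (by omega) b hb, zero_mul]

lemma vaughan_MM {n : ℕ} (Ψ : Polynomial F → ℂ) {u v : ℕ} (hv : 1 ≤ v)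
    (huv : u + v ≤ n) (S : ℝ)
    (hS : ∀ i, v ≤ i → i ≤ n - u → ∀ g₁ ∈ MM F (n - i), ∑ g₂ ∈ MM F (n - i),
      ‖∑ h ∈ MM F i, Ψ (h * g₁) * (starRingEnd ℂ) (Ψ (h * g₂))‖ ≤ S) :
    ‖∑ f ∈ MM F n, (ffLambda f : ℂ) * Ψ f‖ ≤
      2 * (n * ∑ d ∈ Finset.range (u + v + 1), ∑ g ∈ MM F d, ‖∑ h ∈ MM F (n - d), Ψ (g * h)‖) +
      n * (n * Real.sqrt ((Fintype.card F : ℝ) ^ n * S)) := by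
  have e : ∑ f ∈ MM F n, (ffLambda f : ℂ) * Ψ f =
      (∑ f ∈ MM F n, ∑ b ∈ DD f,
        (if b.natDegree ≤ v then mob b * ((f / b).natDegree : ℂ) else 0) * Ψ (b * (f / b)))
      - (∑ f ∈ MM F n, ∑ e ∈ DD f, WW u v e * Ψ (e * (f / e)))
      + ∑ f ∈ MM F n, ∑ b ∈ DD f,
        (if v < b.natDegree then mob b * BB u (f / b) else 0) * Ψ (b * (f / b)) := by
    rw [← Finset.sum_sub_distrib, ← Finset.sum_add_distrib]
    refine Finset.sum_congr rfl fun f hf => ?_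
    rw [mem_MM] at hf
    exact vaughan_point hf.1 (by omega) Ψ
  have b1 := typeI_bound (m := u + v) huv
    (fun b g => if b.natDegree ≤ v then mob b * (g.natDegree : ℂ) else 0) Ψ
    (fun b => if b.natDegree ≤ v then mob b * ((n - b.natDegree : ℕ) : ℂ) else 0)
    (by
      intro i hi b hb g hg
      rw [mem_MM] at hb hg
      rw [hb.2, hg.2])
    (by
      intro i hi b hb
      split_ifs
      · rw [norm_mul, Complex.norm_natCast]
        refine (mul_le_of_le_one_left (Nat.cast_nonneg _) (mob_norm b)).trans ?_
        exact_mod_cast Nat.sub_le _ _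
      · simp)
    (by
      intro i hi hm b hb
      rw [mem_MM] at hb
      rw [if_neg (by omega)])
  have b2 := typeI_bound (m := u + v) huv (fun b g => WW u v b) Ψ (fun b => WW u v b)
    (fun _ _ _ _ _ _ => rfl)
    (by
      intro i hi b hb
      rw [mem_MM] at hb
      refine (WW_norm u v hb.1).trans ?_
      rw [hb.2]
      exact_mod_cast hi)
    (by
      intro i hi hm b hb
      rw [mem_MM] at hb
      exact WW_eq_zero hb.1 (by omega))
  have b3 : ‖∑ f ∈ MM F n, ∑ b ∈ DD f,
        (if v < b.natDegree then mob b * BB u (f / b) else 0) * Ψ (b * (f / b))‖ ≤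
        n * (n * Real.sqrt ((Fintype.card F : ℝ) ^ n * S)) := by
    rw [sum_DD_prod n (fun b g => (if v < b.natDegree then mob b * BB u g else 0) * Ψ (b * g)),
      Finset.sum_range_succ']
    have hz : ∑ b ∈ MM F 0, ∑ g ∈ MM F (n - 0),
        (if v < b.natDegree then mob b * BB u g else 0) * Ψ (b * g) = 0 := by
      refine Finset.sum_eq_zero fun b hb => Finset.sum_eq_zero fun g _ => ?_
      rw [mem_MM] at hb
      rw [if_neg (by omega), zero_mul]
    rw [hz, add_zero]
    calc _ ≤ ∑ i ∈ Finset.range n, n * Real.sqrt ((Fintype.card F : ℝ) ^ n * S) := by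
          refine (norm_sum_le _ _).trans (Finset.sum_le_sum fun j hj => ?_)
          rw [Finset.mem_range] at hj
          obtain ⟨i, hi⟩ : ∃ i, i = j + 1 := ⟨_, rfl⟩
          rw [← hi]
          have h0 : 0 ≤ n * Real.sqrt ((Fintype.card F : ℝ) ^ n * S) := by positivity
          by_cases hiv : v < i
          · by_cases hiu : n - i ≤ u
            · rw [Finset.sum_eq_zero, norm_zero]
              · exact h0
              · intro b hb
                refine Finset.sum_eq_zero fun g hg => ?_
                rw [mem_MM] at hg
                rw [BB_eq_zero hg.1 (by omega)]
                simp
            · have hcs := cs_bound (MM F i) (MM F (n - i)) mob (BB u) (fun h g => Ψ (h * g)) n S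
                (Nat.cast_nonneg _) (fun h _ => mob_norm h)
                (by
                  intro g hg
                  rw [mem_MM] at hg
                  refine (BB_norm u hg.1).trans ?_
                  rw [hg.2]
                  exact_mod_cast Nat.sub_le _ _)
                (hS i hiv.le (by omega))
              have e3 : ∑ b ∈ MM F i, ∑ g ∈ MM F (n - i),
                  (if v < b.natDegree then mob b * BB u g else 0) * Ψ (b * g) =
                  ∑ b ∈ MM F i, ∑ g ∈ MM F (n - i), mob b * BB u g * Ψ (b * g) := by
                refine Finset.sum_congr rfl fun b hb => Finset.sum_congr rfl fun g _ => ?_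
                rw [mem_MM] at hb
                rw [if_pos (by omega)]
              rw [e3]
              rw [card_MM, card_MM, ← Nat.cast_mul, ← pow_add, show i + (n - i) = n by omega,
                mul_assoc] at hcs
              have := Real.abs_le_sqrt hcs
              rw [abs_of_nonneg (norm_nonneg _), Real.sqrt_mul (by positivity),
                Real.sqrt_sq (Nat.cast_nonneg _)] at this
              simpa using this
          · rw [Finset.sum_eq_zero, norm_zero]
            · exact h0
            · intro b hb
              refine Finset.sum_eq_zero fun g hg => ?_
              rw [mem_MM] at hb
              rw [if_neg (by omega), zero_mul]
      _ = _ := by rw [Finset.sum_const, Finset.card_range, nsmul_eq_mul]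
  rw [e]
  refine (norm_add_le _ _).trans ?_
  have := norm_sub_le (∑ f ∈ MM F n, ∑ b ∈ DD f,
        (if b.natDegree ≤ v then mob b * ((f / b).natDegree : ℂ) else 0) * Ψ (b * (f / b)))
      (∑ f ∈ MM F n, ∑ e ∈ DD f, WW u v e * Ψ (e * (f / e)))
  linarith

lemma le_biSup_real (s : Set ℕ) (hs : s.Finite) (φ : ℕ → ℝ) (i : ℕ) (hi : i ∈ s) :
    φ i ≤ ⨆ j ∈ s, φ j := by
  have hb : BddAbove (Set.range fun j => ⨆ _ : j ∈ s, φ j) := by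
    refine ((hs.image φ).insert 0).bddAbove.mono ?_
    rintro _ ⟨j, rfl⟩
    by_cases hj : j ∈ s
    · right
      exact ⟨j, hj, by simp [hj]⟩
    · left
      simp [hj]
  have := le_ciSup hb i
  simpa [hi] using this

end helpers

/-- **Vaughan's identity in `F_q[x]`.** There is an absolute constant `C > 0` such that for
any finite field `F`, any `n ≥ 1`, any `Ψ : F[x] → ℂ` with `|Ψ| ≤ 1`, and any
`u, v ∈ [1, n]` with `u + v ≤ n`,
`|Σ_{f ∈ M(n)} Λ(f)Ψ(f)| ≤ C (n Σ₁ + n^{5/2} q^{n−(u+v)/2} Σ₂^{1/2})`, where monic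
polynomials of degree `d` are identified with vectors in `F^d` via `vecToPoly`. -/
theorem vaughan_identity_Fq :
    ∃ C : ℝ, 0 < C ∧
      ∀ (F : Type) [Field F] [Fintype F] (n : ℕ), 0 < n →
        ∀ Ψ : Polynomial F → ℂ, (∀ f, ‖Ψ f‖ ≤ 1) →
          ∀ u v : ℕ, 1 ≤ u → u ≤ n → 1 ≤ v → v ≤ n → u + v ≤ n →
            ‖∑ w : Fin n → F, (ffLambda (vecToPoly w) : ℂ) * Ψ (vecToPoly w)‖ ≤
              C * ((n : ℝ) *
                  (∑ d ∈ Finset.range (u + v + 1), ∑ g : Fin d → F,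
                    ‖∑ h : Fin (n - d) → F, Ψ (vecToPoly g * vecToPoly h)‖) +
                (n : ℝ) ^ (5 / 2 : ℝ) *
                  (Fintype.card F : ℝ) ^ ((n : ℝ) - ((u : ℝ) + (v : ℝ)) / 2) *
                  Real.sqrt
                    (⨆ i ∈ Set.Icc v (n - u), ⨆ g₁ : Fin (n - i) → F,
                      ∑ g₂ : Fin (n - i) → F,
                        ‖∑ h : Fin i → F,
                            Ψ (vecToPoly h * vecToPoly g₁) *
                              (starRingEnd ℂ) (Ψ (vecToPoly h * vecToPoly g₂))‖)) := by
  refine ⟨2, by norm_num, ?_⟩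
  intro F _ _ n hn Ψ hΨ u v hu hun hv hvn huv
  set S : ℝ := ⨆ i ∈ Set.Icc v (n - u), ⨆ g₁ : Fin (n - i) → F,
                      ∑ g₂ : Fin (n - i) → F,
                        ‖∑ h : Fin i → F,
                            Ψ (vecToPoly h * vecToPoly g₁) *
                              (starRingEnd ℂ) (Ψ (vecToPoly h * vecToPoly g₂))‖ with hSdef
  have hS : ∀ i, v ≤ i → i ≤ n - u → ∀ g₁ ∈ MM F (n - i), ∑ g₂ ∈ MM F (n - i),
      ‖∑ h ∈ MM F i, Ψ (h * g₁) * (starRingEnd ℂ) (Ψ (h * g₂))‖ ≤ S := by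
    intro i h1 h2 g₁ hg₁
    obtain ⟨w, _, rfl⟩ := Finset.mem_image.1 hg₁
    refine le_trans ?_ (le_biSup_real (Set.Icc v (n - u)) (Set.finite_Icc _ _)
      (fun i => ⨆ g₁ : Fin (n - i) → F, ∑ g₂ : Fin (n - i) → F, ‖∑ h : Fin i → F,
        Ψ (vecToPoly h * vecToPoly g₁) * (starRingEnd ℂ) (Ψ (vecToPoly h * vecToPoly g₂))‖)
      i ⟨h1, h2⟩)
    refine le_trans (le_of_eq ?_) (le_ciSup (Set.finite_range _).bddAbove w)
    rw [← sum_MM]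
    refine Finset.sum_congr rfl fun g₂ _ => ?_
    rw [← sum_MM i (fun h => Ψ (h * vecToPoly w) * (starRingEnd ℂ) (Ψ (h * vecToPoly g₂)))]
  have main := vaughan_MM Ψ hv huv S hS
  rw [sum_MM n (fun f => (ffLambda f : ℂ) * Ψ f)]
  have e1 : ∑ d ∈ Finset.range (u + v + 1), ∑ g : Fin d → F,
      ‖∑ h : Fin (n - d) → F, Ψ (vecToPoly g * vecToPoly h)‖ =
      ∑ d ∈ Finset.range (u + v + 1), ∑ g ∈ MM F d, ‖∑ h ∈ MM F (n - d), Ψ (g * h)‖ := by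
    refine Finset.sum_congr rfl fun d _ => ?_
    rw [← sum_MM]
    refine Finset.sum_congr rfl fun g _ => ?_
    rw [← sum_MM (n - d) (fun h => Ψ (vecToPoly g * h))]
  rw [e1]
  refine main.trans ?_
  rw [mul_add]
  refine add_le_add le_rfl ?_
  have hn1 : (1 : ℝ) ≤ n := by exact_mod_cast hn
  have hq1 : (1 : ℝ) ≤ Fintype.card F := by exact_mod_cast Fintype.card_pos
  have huv' : (u : ℝ) + v ≤ n := by exact_mod_cast huv
  have k1 : (n : ℝ) * n ≤ (n : ℝ) ^ (5 / 2 : ℝ) := by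
    rw [← sq, ← Real.rpow_natCast]
    exact Real.rpow_le_rpow_of_exponent_le hn1 (by norm_num)
  have k2 : Real.sqrt ((Fintype.card F : ℝ) ^ n) ≤
      (Fintype.card F : ℝ) ^ ((n : ℝ) - ((u : ℝ) + (v : ℝ)) / 2) := by
    rw [Real.sqrt_eq_rpow, ← Real.rpow_natCast, ← Real.rpow_mul (by positivity)]
    exact Real.rpow_le_rpow_of_exponent_le hq1 (by linarith)
  rw [Real.sqrt_mul (by positivity)]
  have k3 : (n : ℝ) * n * Real.sqrt ((Fintype.card F : ℝ) ^ n) * Real.sqrt S ≤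
      (n : ℝ) ^ (5 / 2 : ℝ) * (Fintype.card F : ℝ) ^ ((n : ℝ) - ((u : ℝ) + (v : ℝ)) / 2) *
        Real.sqrt S := by
    gcongr
  have k4 : 0 ≤ (n : ℝ) ^ (5 / 2 : ℝ) *
      (Fintype.card F : ℝ) ^ ((n : ℝ) - ((u : ℝ) + (v : ℝ)) / 2) * Real.sqrt S := by positivity
  calc (n : ℝ) * (n * (Real.sqrt ((Fintype.card F : ℝ) ^ n) * Real.sqrt S))
      = (n : ℝ) * n * Real.sqrt ((Fintype.card F : ℝ) ^ n) * Real.sqrt S := by ring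
    _ ≤ _ := by linarith
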